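/- Let T : ℂ[z] → ℂ be a linear functional, n ≥ 1, and let R_{n-1}/S_n and R_n/S_{n+1} be the [n−1/n] and [n/n+1] Padé approximants of F_T at infinity. Then T is n-degenerate (there is a nonzero polynomial p with deg p ≤ n such that T(p·q) = 0 for all q with deg q ≤ n) if and only if deg S_{n+1} ≤ n. -/

import Mathlib

/-- The polynomial `S(x)` viewed in `ℂ((x⁻¹))`, realized as the Laurent series field
`LaurentSeries ℂ = ℂ((X))` with `X = x⁻¹`, by evaluating `S` at `X⁻¹`. -/
noncomputable def polyLS (S : Polynomial ℂ) : LaurentSeries ℂ :=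
  Polynomial.aeval ((PowerSeries.X : PowerSeries ℂ) : LaurentSeries ℂ)⁻¹ S

/-- The series `∑_{n≥0} a n · x^{-n-1}`, i.e. `∑ a n · X^{n+1}` with `X = x⁻¹`. -/
noncomputable def seqLS (a : ℕ → ℂ) : LaurentSeries ℂ :=
  ((PowerSeries.mk a : PowerSeries ℂ) : LaurentSeries ℂ) *
    ((PowerSeries.X : PowerSeries ℂ) : LaurentSeries ℂ)

/-- The formal Stieltjes transform `F_T(x) = ∑_{n≥0} x^{-n-1} T(z^n)` of a linear
functional `T` on `ℂ[z]`. -/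
noncomputable def stieltjes (T : Polynomial ℂ →ₗ[ℂ] ℂ) : LaurentSeries ℂ :=
  seqLS fun n => T (Polynomial.X ^ n)

theorem polyLS_mul (p q : Polynomial ℂ) : polyLS (p * q) = polyLS p * polyLS q :=
  map_mul _ p q

theorem polyLS_add (p q : Polynomial ℂ) : polyLS (p + q) = polyLS p + polyLS q :=
  map_add _ p q

theorem coeff_polyLS_mul (p : Polynomial ℂ) (f : LaurentSeries ℂ) (m : ℤ) :
    (polyLS p * f).coeff m = p.sum fun i c => c * f.coeff (m + i) := by
  have hX : ∀ i : ℕ, (((PowerSeries.X : PowerSeries ℂ) : LaurentSeries ℂ)⁻¹) ^ i =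
      HahnSeries.single (-(i : ℤ)) 1 := by
    intro i
    rw [PowerSeries.coe_X, HahnSeries.inv_single, HahnSeries.single_pow]
    simp
  induction p using Polynomial.induction_on' with
  | add p q hp hq =>
    rw [polyLS_add, add_mul, HahnSeries.coeff_add, hp, hq,
      Polynomial.sum_add_index] <;> simp [add_mul]
  | monomial i c =>
    rw [polyLS, Polynomial.aeval_monomial, hX, Polynomial.sum_monomial_index _ _ (by simp),
      HahnSeries.algebraMap_apply', PowerSeries.algebraMap_apply, Algebra.algebraMap_self_apply,
      HahnSeries.ofPowerSeries_C, mul_assoc, HahnSeries.C_mul_eq_smul, HahnSeries.coeff_smul,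
      smul_eq_mul]
    have h := HahnSeries.coeff_single_mul_add (r := (1 : ℂ)) (x := f) (a := m + i) (b := -(i : ℤ))
    rw [show m + i + -(i : ℤ) = m by ring, one_mul] at h
    rw [h]

theorem coeff_polyLS_neg (p : Polynomial ℂ) (k : ℕ) : (polyLS p).coeff (-(k : ℤ)) = p.coeff k := by
  rw [← mul_one (polyLS p), coeff_polyLS_mul, Polynomial.sum_def, Finset.sum_eq_single k]
  · simp
  · intro i _ hi
    have : -(k : ℤ) + i ≠ 0 := by lia
    simp [HahnSeries.coeff_one, this]
  · simp +contextual

theorem coeff_polyLS_of_pos (p : Polynomial ℂ) {m : ℤ} (hm : 0 < m) : (polyLS p).coeff m = 0 := by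
  rw [← mul_one (polyLS p), coeff_polyLS_mul, Polynomial.sum_def]
  refine Finset.sum_eq_zero fun i _ => ?_
  have : m + i ≠ 0 := by lia
  simp [HahnSeries.coeff_one, this]

theorem polyLS_ne_zero {p : Polynomial ℂ} (hp : p ≠ 0) : polyLS p ≠ 0 := by
  intro h
  have := coeff_polyLS_neg p p.natDegree
  rw [h] at this
  exact hp (Polynomial.leadingCoeff_eq_zero.mp this.symm)

theorem order_polyLS {p : Polynomial ℂ} (hp : p ≠ 0) : (polyLS p).order = -(p.natDegree : ℤ) := by
  apply le_antisymm
  · apply HahnSeries.order_le_of_coeff_ne_zero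
    rw [coeff_polyLS_neg]
    simpa using hp
  · by_contra! h
    obtain ⟨k, hk⟩ := Int.exists_eq_neg_ofNat (a := (polyLS p).order) (by lia)
    have h0 := HahnSeries.coeff_order_eq_zero.not.mpr (polyLS_ne_zero hp)
    rw [hk, coeff_polyLS_neg] at h0
    exact h0 (Polynomial.coeff_eq_zero_of_natDegree_lt (by lia))

theorem coeff_stieltjes (T : Polynomial ℂ →ₗ[ℂ] ℂ) (k : ℕ) :
    (stieltjes T).coeff (1 + k) = T (Polynomial.X ^ k) := by
  rw [stieltjes, seqLS, PowerSeries.coe_X, add_comm, HahnSeries.coeff_mul_single_add, mul_one]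
  simp

theorem apply_eq_sum (T : Polynomial ℂ →ₗ[ℂ] ℂ) (p : Polynomial ℂ) :
    T p = p.sum fun i c => c * T (Polynomial.X ^ i) := by
  conv_lhs => rw [p.as_sum_support_C_mul_X_pow]
  simp [Polynomial.sum_def, Polynomial.C_mul']

/-- If `G` agrees with `F_T` up to order `N`, then `T p` is the residue of `p G` for
all `p` of degree less than `N`. -/
theorem apply_eq_coeff_polyLS_mul (T : Polynomial ℂ →ₗ[ℂ] ℂ) (G : LaurentSeries ℂ) (N : ℕ)
    (h : ∀ m : ℤ, m < N + 1 → (stieltjes T - G).coeff m = 0) (p : Polynomial ℂ)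
    (hp : p.natDegree < N) : T p = (polyLS p * G).coeff 1 := by
  rw [apply_eq_sum, coeff_polyLS_mul]
  refine Finset.sum_congr rfl fun i hi => ?_
  have hi' := Polynomial.le_natDegree_of_mem_supp i hi
  have := h (1 + i) (by lia)
  rw [HahnSeries.coeff_sub, coeff_stieltjes, sub_eq_zero] at this
  simp only [this]

theorem coeff_polyLS_mul_div_eq_zero {r s : Polynomial ℂ} (hs : s ≠ 0) (q : Polynomial ℂ) :
    (polyLS (s * q) * (polyLS r / polyLS s)).coeff 1 = 0 := by
  have h : polyLS (s * q) * (polyLS r / polyLS s) = polyLS (q * r) := by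
    have := polyLS_ne_zero hs
    rw [polyLS_mul, polyLS_mul]
    field_simp
  rw [h, coeff_polyLS_of_pos _ one_pos]

/-- A rational function whose expansion at infinity has no negative powers is a polynomial. -/
theorem dvd_of_coeff_polyLS_mul_div_eq_zero {r s : Polynomial ℂ} (hs : s.Monic)
    (h : ∀ j : ℕ, (polyLS (Polynomial.X ^ j) * (polyLS r / polyLS s)).coeff 1 = 0) : s ∣ r := by
  rw [← Polynomial.modByMonic_eq_zero_iff_dvd hs]
  by_contra hw
  set w := r %ₘ s
  have hs0 := polyLS_ne_zero hs.ne_zero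
  have hw0 := polyLS_ne_zero hw
  have hsplit : polyLS r / polyLS s = polyLS w / polyLS s + polyLS (r /ₘ s) := by
    conv_lhs => rw [← Polynomial.modByMonic_add_div r s, polyLS_add, polyLS_mul]
    rw [add_div, mul_div_cancel_left₀ _ hs0]
  have hne : polyLS w / polyLS s ≠ 0 := div_ne_zero hw0 hs0
  have hord := HahnSeries.order_mul hne hs0
  rw [div_mul_cancel₀ _ hs0, order_polyLS hw, order_polyLS hs.ne_zero] at hord
  have hlt : w.natDegree < s.natDegree :=
    Polynomial.natDegree_lt_natDegree hw (Polynomial.degree_modByMonic_lt r hs)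
  obtain ⟨j, hj⟩ := Int.eq_ofNat_of_zero_le
    (a := (polyLS w / polyLS s).order - 1) (by lia)
  have hc := h j
  rw [coeff_polyLS_mul, Polynomial.X_pow_eq_monomial,
    Polynomial.sum_monomial_index _ _ (by simp), one_mul, hsplit, HahnSeries.coeff_add,
    coeff_polyLS_of_pos _ (by lia), add_zero,
    show (1 : ℤ) + j = (polyLS w / polyLS s).order by lia] at hc
  exact hne (HahnSeries.coeff_order_eq_zero.mp hc)

/-- let `r₁/s₁` and `r₂/s₂` be the `[n−1/n]` and `[n/n+1]` Padé approximants
of `F_T` at infinity.  Then `T` is `n`-degenerate (some nonzero `p` of degree `≤ n` has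
`T(p·q) = 0` for all `q` of degree `≤ n`) iff `deg s₂ ≤ n`. -/
theorem statement11 (T : Polynomial ℂ →ₗ[ℂ] ℂ) (n : ℕ) (hn : 1 ≤ n)
    (r₁ s₁ r₂ s₂ : Polynomial ℂ)
    (hs₁ : s₁.Monic) (hd₁ : s₁.natDegree ≤ n) (hr₁ : r₁.degree < s₁.degree)
    (hc₁ : IsCoprime r₁ s₁)
    (h₁ : ∀ m : ℤ, m < 2 * n + 1 → (stieltjes T - polyLS r₁ / polyLS s₁).coeff m = 0)
    (hs₂ : s₂.Monic) (hd₂ : s₂.natDegree ≤ n + 1) (hr₂ : r₂.degree < s₂.degree)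
    (hc₂ : IsCoprime r₂ s₂)
    (h₂ : ∀ m : ℤ, m < 2 * n + 3 → (stieltjes T - polyLS r₂ / polyLS s₂).coeff m = 0) :
    (∃ p : Polynomial ℂ, p ≠ 0 ∧ p.degree ≤ (n : WithBot ℕ) ∧
        ∀ q : Polynomial ℂ, q.degree ≤ (n : WithBot ℕ) → T (p * q) = 0)
      ↔ s₂.natDegree ≤ n := by
  have key := apply_eq_coeff_polyLS_mul T (polyLS r₂ / polyLS s₂) (2 * n + 2)
    (fun m hm => h₂ m (by push_cast at hm; lia))
  constructor
  · rintro ⟨p, hp, hpd, hpT⟩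
    by_contra! hlt
    have hpn : p.natDegree ≤ n := Polynomial.natDegree_le_of_degree_le hpd
    have hdvd : s₂ ∣ p * r₂ := by
      refine dvd_of_coeff_polyLS_mul_div_eq_zero hs₂ fun j => ?_
      set q := (Polynomial.X ^ j : Polynomial ℂ) %ₘ s₂
      have hqn : q.natDegree ≤ n := by
        have := Polynomial.natDegree_modByMonic_lt (Polynomial.X ^ j : Polynomial ℂ) hs₂
          (by rintro rfl; simp at hlt)
        lia
      have hT := key (p * q) (by have := Polynomial.natDegree_mul_le (p := p) (q := q); lia)
      rw [hpT q (Polynomial.degree_le_of_natDegree_le hqn)] at hT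
      have hsplit : polyLS (Polynomial.X ^ j) * (polyLS (p * r₂) / polyLS s₂) =
          polyLS (p * q) * (polyLS r₂ / polyLS s₂) +
            polyLS (s₂ * ((Polynomial.X ^ j /ₘ s₂) * p)) * (polyLS r₂ / polyLS s₂) := by
        rw [← add_mul, ← polyLS_add, polyLS_mul p r₂, mul_div_assoc, ← mul_assoc, ← polyLS_mul]
        congr 2
        conv_lhs => rw [← Polynomial.modByMonic_add_div (Polynomial.X ^ j) s₂]
        ring
      rw [hsplit, HahnSeries.coeff_add, ← hT, coeff_polyLS_mul_div_eq_zero hs₂.ne_zero, add_zero]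
    have := Polynomial.natDegree_le_of_dvd (hc₂.symm.dvd_of_dvd_mul_right hdvd) hp
    lia
  · intro hle
    refine ⟨s₂, hs₂.ne_zero, Polynomial.degree_le_of_natDegree_le hle, fun q hq => ?_⟩
    have hqn : q.natDegree ≤ n := Polynomial.natDegree_le_of_degree_le hq
    rw [key (s₂ * q) (by have := Polynomial.natDegree_mul_le (p := s₂) (q := q); lia),
      coeff_polyLS_mul_div_eq_zero hs₂.ne_zero]
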